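/- Fix 𝐡 = (h₀,h₁,h₂) ∈ ℕ³ and J ∈ S¹. (a) If φ is a smooth J-monogenic function on an open subset V of ℝ³_J, then ∇^𝐡_Jφ = J^{h₂}·δ^𝐡_Jφ on V. (b) If f : Ω → ℍ is a (1,3)-regular function of class C^{|𝐡|} on a domain Ω ⊆ ℍ, then the restriction of δ^𝐡f to Ω ∩ ℝ³_J equals J^{−h₂}·∇^𝐡_J f_J. -/

import Mathlib

open Quaternion

noncomputable section

/-- The real quaternions. -/
abbrev H : Type := Quaternion ℝ

/-- The imaginary unit `i`. -/
def qi : H := ⟨0, 1, 0, 0⟩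
/-- The imaginary unit `j`. -/
def qj : H := ⟨0, 0, 1, 0⟩
/-- The imaginary unit `k`. -/
def qk : H := ⟨0, 0, 0, 1⟩

/-- `S¹`: the circle of unit quaternions in the plane `jℝ + kℝ`. -/
def S1 : Set H := {J : H | J.re = 0 ∧ J.imI = 0 ∧ J.imJ ^ 2 + J.imK ^ 2 = 1}

/-- The subset `ℂ = ℝ + iℝ` of `ℍ` (the mirror). -/
def Cset : Set H := {x : H | x.imJ = 0 ∧ x.imK = 0}

/-- Coordinates `(x₀,x₁,β) ↦ x₀ + i x₁ + β J` for the hyperplane `ℝ³_J`. -/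
def psi (J : H) (u : ℝ × ℝ × ℝ) : H := (u.1 : H) + u.2.1 • qi + u.2.2 • J

/-- The hyperplane `ℝ³_J = Span_ℝ(1, i, J)` of `ℍ`, as the range of `psi J`. -/
def hplane (J : H) : Set H := Set.range (psi J)

/-- `f` is `J`-monogenic on the `J`-hplane of `Ω`: in the coordinates `(x₀,x₁,β)`,
the restriction of `f` to `Ω ∩ ℝ³_J` is real-differentiable and satisfies
`∂_{x₀}f + i·∂_{x₁}f + J·∂_βf = 0`. -/
def JMonogenicOn (J : H) (f : H → H) (Ω : Set H) : Prop :=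
  ∀ u : ℝ × ℝ × ℝ, psi J u ∈ Ω →
    DifferentiableAt ℝ (fun v => f (psi J v)) u ∧
    fderiv ℝ (fun v => f (psi J v)) u (1, 0, 0)
      + qi * fderiv ℝ (fun v => f (psi J v)) u (0, 1, 0)
      + J * fderiv ℝ (fun v => f (psi J v)) u (0, 0, 1) = 0

/-- `f` is `(1,3)`-regular on `Ω`: for every `J ∈ S¹`, the restriction of `f`
to `Ω ∩ ℝ³_J` is `J`-monogenic. -/
def Regular13 (f : H → H) (Ω : Set H) : Prop :=
  ∀ J ∈ S1, JMonogenicOn J f Ω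

/-- Partial derivative of `φ : ℝ³ → ℍ` in the direction `e`. -/
def pd (e : ℝ × ℝ × ℝ) (φ : ℝ × ℝ × ℝ → H) : ℝ × ℝ × ℝ → H :=
  fun u => fderiv ℝ φ u e

/-- `∇^𝐡_J = ∂_{x₀}^{h₀}∂_{x₁}^{h₁}∂_β^{h₂}` in the coordinates `(x₀,x₁,β)` of `ℝ³_J`. -/
def nabla (h : ℕ × ℕ × ℕ) (φ : ℝ × ℝ × ℝ → H) : ℝ × ℝ × ℝ → H :=
  (pd (1, 0, 0))^[h.1] ((pd (0, 1, 0))^[h.2.1] ((pd (0, 0, 1))^[h.2.2] φ))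

/-- The operator `∂₀ + i·∂₁` on functions `ℝ³ → ℍ` (`i` acting by left multiplication). -/
def cauchyOp (φ : ℝ × ℝ × ℝ → H) : ℝ × ℝ × ℝ → H :=
  fun u => pd (1, 0, 0) φ u + qi * pd (0, 1, 0) φ u

/-- The operator `∂₀² + ∂₁²` on functions `ℝ³ → ℍ`. -/
def lap01 (φ : ℝ × ℝ × ℝ → H) : ℝ × ℝ × ℝ → H :=
  fun u => pd (1, 0, 0) (pd (1, 0, 0) φ) u + pd (0, 1, 0) (pd (0, 1, 0) φ) u

/-- The operator `δ^𝐡_J`: `δ^{(h₀,h₁,2t)} = ∂₀^{h₀}∂₁^{h₁}(∂₀²+∂₁²)^t` and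
`δ^{(h₀,h₁,2t+1)} = ∂₀^{h₀}∂₁^{h₁}(∂₀²+∂₁²)^t(∂₀+i∂₁)`, in the coordinates of `ℝ³_J`. -/
def deltaOp (h : ℕ × ℕ × ℕ) (φ : ℝ × ℝ × ℝ → H) : ℝ × ℝ × ℝ → H :=
  (pd (1, 0, 0))^[h.1] ((pd (0, 1, 0))^[h.2.1]
    (lap01^[h.2.2 / 2] (if h.2.2 % 2 = 1 then cauchyOp φ else φ)))

/-- Partial derivative of `f : ℍ → ℍ` in the direction `e ∈ ℍ`. -/
def pdH (e : H) (f : H → H) : H → H :=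
  fun x => fderiv ℝ f x e

/-- The operator `∂₀ + i·∂₁` on functions `ℍ → ℍ` (`∂₀, ∂₁` in the directions `1, i`). -/
def cauchyOpH (f : H → H) : H → H :=
  fun x => pdH 1 f x + qi * pdH qi f x

/-- The operator `∂₀² + ∂₁²` on functions `ℍ → ℍ`. -/
def lap01H (f : H → H) : H → H :=
  fun x => pdH 1 (pdH 1 f) x + pdH qi (pdH qi f) x

/-- The operator `δ^𝐡` on functions `ℍ → ℍ`: `δ^{(h₀,h₁,2t)} = ∂₀^{h₀}∂₁^{h₁}(∂₀²+∂₁²)^t`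
and `δ^{(h₀,h₁,2t+1)} = ∂₀^{h₀}∂₁^{h₁}(∂₀²+∂₁²)^t(∂₀+i∂₁)`. -/
def deltaOpH (h : ℕ × ℕ × ℕ) (f : H → H) : H → H :=
  (pdH 1)^[h.1] ((pdH qi)^[h.2.1]
    (lap01H^[h.2.2 / 2] (if h.2.2 % 2 = 1 then cauchyOpH f else f)))

section DirectionalDerivative

variable {E F : Type*} [NormedAddCommGroup E] [NormedSpace ℝ E]
  [NormedAddCommGroup F] [NormedSpace ℝ F]

/-- Directional derivative of a quaternion-valued function. -/
def dirDeriv (e : E) (φ : E → H) : E → H := fun u => fderiv ℝ φ u e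

/-- Sum of the second directional derivatives along `a` and `b`. -/
def lapDir (a b : E) (φ : E → H) : E → H :=
  dirDeriv a (dirDeriv a φ) + dirDeriv b (dirDeriv b φ)

/-- The operator `∂_a + i ∂_b`. -/
def cauchyDir (a b : E) (φ : E → H) : E → H := dirDeriv a φ + qi • dirDeriv b φ

lemma dirDeriv_smul {q : H} (hq : q ≠ 0) (e : E) (φ : E → H) :
    dirDeriv e (q • φ) = q • dirDeriv e φ := by
  funext u
  by_cases hd : DifferentiableAt ℝ φ u
  · simp [dirDeriv, fderiv_const_smul hd]
  · have hd' : ¬ DifferentiableAt ℝ (q • φ) u := fun h' => hd <| by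
      simpa [smul_smul, inv_mul_cancel₀ hq] using h'.const_smul q⁻¹
    simp [dirDeriv, fderiv_zero_of_not_differentiableAt hd,
      fderiv_zero_of_not_differentiableAt hd']

lemma dirDeriv_iterate_smul {q : H} (hq : q ≠ 0) (e : E) (k : ℕ) (φ : E → H) :
    (dirDeriv e)^[k] (q • φ) = q • (dirDeriv e)^[k] φ :=
  Function.Commute.iterate_left (f := dirDeriv e) (g := fun ψ : E → H => q • ψ)
    (dirDeriv_smul hq e) k φ

lemma lapDir_smul {q : H} (hq : q ≠ 0) (a b : E) (φ : E → H) :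
    lapDir a b (q • φ) = q • lapDir a b φ := by
  simp only [lapDir, dirDeriv_smul hq, smul_add]

lemma lapDir_iterate_smul {q : H} (hq : q ≠ 0) (a b : E) (k : ℕ) (φ : E → H) :
    (lapDir a b)^[k] (q • φ) = q • (lapDir a b)^[k] φ :=
  Function.Commute.iterate_left (f := lapDir a b) (g := fun ψ : E → H => q • ψ)
    (lapDir_smul hq a b) k φ

variable {V : Set E} {φ ψ : E → H}

lemma dirDeriv_congr (hV : IsOpen V) (h : Set.EqOn φ ψ V) (e : E) :
    Set.EqOn (dirDeriv e φ) (dirDeriv e ψ) V := fun u hu => by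
  simp only [dirDeriv]
  rw [(h.eventuallyEq_of_mem (hV.mem_nhds hu)).fderiv_eq]

lemma dirDeriv_iterate_congr (hV : IsOpen V) (h : Set.EqOn φ ψ V) (e : E) (k : ℕ) :
    Set.EqOn ((dirDeriv e)^[k] φ) ((dirDeriv e)^[k] ψ) V := by
  induction k generalizing φ ψ with
  | zero => exact h
  | succ k ih => exact ih (dirDeriv_congr hV h e)

lemma lapDir_congr (hV : IsOpen V) (h : Set.EqOn φ ψ V) (a b : E) :
    Set.EqOn (lapDir a b φ) (lapDir a b ψ) V := fun _ hu =>
  congrArg₂ (· + ·) (dirDeriv_congr hV (dirDeriv_congr hV h a) a hu)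
    (dirDeriv_congr hV (dirDeriv_congr hV h b) b hu)

lemma lapDir_iterate_congr (hV : IsOpen V) (h : Set.EqOn φ ψ V) (a b : E) (k : ℕ) :
    Set.EqOn ((lapDir a b)^[k] φ) ((lapDir a b)^[k] ψ) V := by
  induction k generalizing φ ψ with
  | zero => exact h
  | succ k ih => exact ih (lapDir_congr hV h a b)

lemma contDiffOn_dirDeriv (hV : IsOpen V) {n : ℕ} (h : ContDiffOn ℝ (n + 1 : ℕ) φ V) (e : E) :
    ContDiffOn ℝ n (dirDeriv e φ) V :=
  (h.fderiv_of_isOpen hV (by norm_cast)).clm_apply contDiffOn_const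

lemma contDiffOn_dirDeriv_iterate (hV : IsOpen V) {n k : ℕ}
    (h : ContDiffOn ℝ (n + k : ℕ) φ V) (e : E) :
    ContDiffOn ℝ n ((dirDeriv e)^[k] φ) V := by
  induction k generalizing φ with
  | zero => exact h
  | succ k ih => exact ih (contDiffOn_dirDeriv hV h e)

lemma contDiffOn_lapDir (hV : IsOpen V) {n : ℕ} (h : ContDiffOn ℝ (n + 2 : ℕ) φ V) (a b : E) :
    ContDiffOn ℝ n (lapDir a b φ) V :=
  (contDiffOn_dirDeriv hV (contDiffOn_dirDeriv hV h a) a).add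
    (contDiffOn_dirDeriv hV (contDiffOn_dirDeriv hV h b) b)

lemma contDiffOn_lapDir_iterate (hV : IsOpen V) {n k : ℕ}
    (h : ContDiffOn ℝ (n + 2 * k : ℕ) φ V) (a b : E) :
    ContDiffOn ℝ n ((lapDir a b)^[k] φ) V := by
  induction k generalizing φ with
  | zero => exact h
  | succ k ih => exact ih (contDiffOn_lapDir hV h a b)

lemma contDiffOn_cauchyDir (hV : IsOpen V) {n : ℕ} (h : ContDiffOn ℝ (n + 1 : ℕ) φ V) (a b : E) :
    ContDiffOn ℝ n (cauchyDir a b φ) V :=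
  (contDiffOn_dirDeriv hV h a).add ((contDiffOn_dirDeriv hV h b).const_smul qi)

lemma differentiableAt_of_contDiffOn_succ (hV : IsOpen V) {n : ℕ}
    (h : ContDiffOn ℝ (n + 1 : ℕ) φ V) {u : E} (hu : u ∈ V) : DifferentiableAt ℝ φ u :=
  (h.contDiffAt (hV.mem_nhds hu)).differentiableAt (by norm_cast)

lemma dirDeriv_add (e : E) {u : E} (h₁ : DifferentiableAt ℝ φ u) (h₂ : DifferentiableAt ℝ ψ u) :
    dirDeriv e (φ + ψ) u = dirDeriv e φ u + dirDeriv e ψ u := by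
  simp [dirDeriv, fderiv_add h₁ h₂]

lemma dirDeriv_comm (hV : IsOpen V) {n : ℕ} (h : ContDiffOn ℝ (n + 2 : ℕ) φ V) (a b : E) :
    Set.EqOn (dirDeriv a (dirDeriv b φ)) (dirDeriv b (dirDeriv a φ)) V := fun u hu => by
  have hd : DifferentiableAt ℝ (fderiv ℝ φ) u :=
    ((h.fderiv_of_isOpen (m := 1) hV (by norm_cast; omega)).contDiffAt
      (hV.mem_nhds hu)).differentiableAt (by norm_num)
  have hs : IsSymmSndFDerivAt ℝ φ u :=
    (h.contDiffAt (hV.mem_nhds hu)).isSymmSndFDerivAt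
      (by simp only [minSmoothness_of_isRCLikeNormedField]; norm_cast; omega)
  have key (x y : E) : dirDeriv x (dirDeriv y φ) u = fderiv ℝ (fderiv ℝ φ) u x y := by
    unfold dirDeriv
    rw [fderiv_clm_apply hd (differentiableAt_const y)]
    simp
  rw [key, key, hs.eq]

lemma dirDeriv_lapDir_comm (hV : IsOpen V) {n : ℕ} (h : ContDiffOn ℝ (n + 3 : ℕ) φ V)
    (a b c : E) : Set.EqOn (dirDeriv c (lapDir a b φ)) (lapDir a b (dirDeriv c φ)) V := by
  have key (x : E) : Set.EqOn (dirDeriv c (dirDeriv x (dirDeriv x φ)))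
      (dirDeriv x (dirDeriv x (dirDeriv c φ))) V :=
    (dirDeriv_comm hV (contDiffOn_dirDeriv (n := n + 2) hV h x) c x).trans
      (dirDeriv_congr hV (dirDeriv_comm (n := n + 1) hV h c x) x)
  have hd (x : E) {u : E} (hu : u ∈ V) : DifferentiableAt ℝ (dirDeriv x (dirDeriv x φ)) u :=
    differentiableAt_of_contDiffOn_succ (n := n) hV
      (contDiffOn_dirDeriv hV (contDiffOn_dirDeriv (n := n + 2) hV h x) x) hu
  intro u hu
  rw [lapDir, dirDeriv_add c (hd a hu) (hd b hu), key a hu, key b hu]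
  rfl

lemma dirDeriv_dirDeriv_lapDir (hV : IsOpen V) {n : ℕ} (h : ContDiffOn ℝ (n + 4 : ℕ) φ V)
    {a b c : E}
    (hφ : Set.EqOn (dirDeriv c (dirDeriv c φ)) ((-1 : H) • lapDir a b φ) V) :
    Set.EqOn (dirDeriv c (dirDeriv c (lapDir a b φ)))
      ((-1 : H) • lapDir a b (lapDir a b φ)) V := by
  rw [← lapDir_smul (neg_ne_zero.2 one_ne_zero)]
  exact ((dirDeriv_congr hV (dirDeriv_lapDir_comm (n := n + 1) hV h a b c) c).trans
    (dirDeriv_lapDir_comm hV (contDiffOn_dirDeriv (n := n + 3) hV h c) a b c)).trans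
    (lapDir_congr hV hφ a b)

/-- Even iterates of `∂_c` on functions satisfying `∂_c² φ = -(∂_a² + ∂_b²) φ`. -/
lemma dirDeriv_iterate_two_mul (hV : IsOpen V) {a b c : E} (t : ℕ)
    (h : ContDiffOn ℝ (2 * t : ℕ) φ V)
    (hφ : 1 ≤ t → Set.EqOn (dirDeriv c (dirDeriv c φ)) ((-1 : H) • lapDir a b φ) V) :
    Set.EqOn ((dirDeriv c)^[2 * t] φ) (((-1 : H) ^ t) • (lapDir a b)^[t] φ) V := by
  induction t generalizing φ with
  | zero => intro u _; simp
  | succ t ih =>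
    have hneg : (-1 : H) ≠ 0 := neg_ne_zero.2 one_ne_zero
    have hlap := ih (contDiffOn_lapDir hV h a b) fun ht => by
      obtain ⟨s, rfl⟩ := Nat.exists_eq_add_of_le' ht
      exact dirDeriv_dirDeriv_lapDir (n := 2 * s) hV h (hφ (by omega))
    intro u hu
    have hstep := dirDeriv_iterate_congr hV (hφ (by omega)) c (2 * t) hu
    rw [dirDeriv_iterate_smul hneg, Pi.smul_apply, hlap hu] at hstep
    rw [pow_succ', mul_smul]
    exact hstep

section Monogenic

variable {a b c : E} {J : H}

lemma S1.mul_self (hJ : J ∈ S1) : J * J = -1 := by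
  obtain ⟨h0, h1, h2⟩ := hJ
  ext <;> simp [h0, h1] <;> nlinarith

lemma S1.ne_zero (hJ : J ∈ S1) : J ≠ 0 := by
  rintro rfl
  simpa using S1.mul_self hJ

@[simp] lemma qi_re : qi.re = 0 := rfl

@[simp] lemma qi_imI : qi.imI = 1 := rfl

@[simp] lemma qi_imJ : qi.imJ = 0 := rfl

@[simp] lemma qi_imK : qi.imK = 0 := rfl

lemma S1.mul_qi_mul (hJ : J ∈ S1) : J * (qi * J) = qi := by
  obtain ⟨h0, h1, h2⟩ := hJ
  ext <;> simp [h0, h1] <;> nlinarith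

lemma qi_mul_self : qi * qi = -1 := by
  ext <;> simp

/-- A monogenic `C²` function satisfies `∂_c² φ = -(∂_a² + ∂_b²) φ`. -/
lemma dirDeriv_dirDeriv_of_monogenic (hJ : J ∈ S1) (hV : IsOpen V) {n : ℕ}
    (h : ContDiffOn ℝ (n + 2 : ℕ) φ V)
    (hm : Set.EqOn (dirDeriv c φ) (J • cauchyDir a b φ) V) :
    Set.EqOn (dirDeriv c (dirDeriv c φ)) ((-1 : H) • lapDir a b φ) V := by
  intro u hu
  have hqi : qi ≠ 0 := fun h0 => by simpa [h0] using qi_mul_self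
  have hd (x : E) : DifferentiableAt ℝ (dirDeriv x φ) u :=
    differentiableAt_of_contDiffOn_succ (n := n) hV (contDiffOn_dirDeriv hV h x) hu
  have hC (x : E) : dirDeriv x (cauchyDir a b φ) u =
      dirDeriv x (dirDeriv a φ) u + qi * dirDeriv x (dirDeriv b φ) u := by
    rw [cauchyDir, dirDeriv_add x (hd a) ((hd b).const_smul qi), dirDeriv_smul hqi]
    rfl
  have hmx (x : E) : dirDeriv x (dirDeriv c φ) u = J * dirDeriv x (cauchyDir a b φ) u := by
    rw [dirDeriv_congr hV hm x hu, dirDeriv_smul (S1.ne_zero hJ)]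
    rfl
  have h1 := S1.mul_self hJ
  have h2 := S1.mul_qi_mul hJ
  have h3 := qi_mul_self
  rw [hmx, hC, dirDeriv_comm hV h c a hu, dirDeriv_comm hV h c b hu, hmx, hmx, hC, hC,
    dirDeriv_comm hV h b a hu]
  simp only [lapDir, Pi.smul_apply, Pi.add_apply, smul_eq_mul]
  generalize dirDeriv a (dirDeriv a φ) u = A
  generalize dirDeriv a (dirDeriv b φ) u = B
  generalize dirDeriv b (dirDeriv b φ) u = D
  calc J * (J * (A + qi * B) + qi * (J * (B + qi * D)))
      = (J * J) * (A + qi * B) + (J * (qi * J)) * (B + qi * D) := by noncomm_ring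
    _ = -1 * (A + qi * B) + qi * (B + qi * D) := by rw [h1, h2]
    _ = -A + (qi * qi) * D := by noncomm_ring
    _ = -1 * (A + D) := by rw [h3]; noncomm_ring

/-- Iterates of `∂_c` on monogenic functions. -/
lemma dirDeriv_iterate_of_monogenic (hJ : J ∈ S1) (hV : IsOpen V) (m : ℕ)
    (h : ContDiffOn ℝ m φ V)
    (hm : Set.EqOn (dirDeriv c φ) (J • cauchyDir a b φ) V) :
    Set.EqOn ((dirDeriv c)^[m] φ)
      (J ^ m • (lapDir a b)^[m / 2] (if m % 2 = 1 then cauchyDir a b φ else φ)) V := by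
  have hpow (t : ℕ) : J ^ (2 * t) = (-1) ^ t := by rw [pow_mul, sq, S1.mul_self hJ]
  obtain ⟨t, rfl | rfl⟩ := Nat.even_or_odd' m
  · rw [hpow, if_neg (by omega), Nat.mul_div_cancel_left t (by norm_num)]
    refine dirDeriv_iterate_two_mul hV t h fun ht => ?_
    obtain ⟨s, rfl⟩ := Nat.exists_eq_add_of_le' ht
    exact dirDeriv_dirDeriv_of_monogenic (n := 2 * s) hJ hV h hm
  · have hJ0 := S1.ne_zero hJ
    rw [if_pos (by omega), show (2 * t + 1) / 2 = t by omega, pow_succ, hpow, mul_smul,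
      ← lapDir_iterate_smul hJ0]
    have hstep : Set.EqOn ((dirDeriv c)^[2 * t] (J • cauchyDir a b φ))
        ((-1 : H) ^ t • (lapDir a b)^[t] (dirDeriv c φ)) V := by
      refine (dirDeriv_iterate_congr hV hm c (2 * t)).symm.trans ?_
      refine dirDeriv_iterate_two_mul hV t (contDiffOn_dirDeriv hV h c) fun ht => ?_
      obtain ⟨s, rfl⟩ := Nat.exists_eq_add_of_le' ht
      have h' : ContDiffOn ℝ (2 * s + 3 : ℕ) φ V := h
      have hφ := dirDeriv_dirDeriv_of_monogenic (n := 2 * s + 1) hJ hV h' hm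
      have hneg : (-1 : H) ≠ 0 := neg_ne_zero.2 one_ne_zero
      intro u hu
      rw [dirDeriv_congr hV hφ c hu, dirDeriv_smul hneg]
      exact congrArg (fun x => (-1 : H) * x) (dirDeriv_lapDir_comm hV h' a b c hu)
    intro u hu
    have h1 := dirDeriv_iterate_congr hV hm c (2 * t) hu
    rw [hstep hu, Pi.smul_apply, lapDir_iterate_congr hV hm a b t hu] at h1
    exact h1

end Monogenic

section Restriction

variable {Ω : Set F} {f : F → H}

lemma dirDeriv_comp (hΩ : IsOpen Ω) {n : ℕ} (hf : ContDiffOn ℝ (n + 1 : ℕ) f Ω)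
    (A : E →L[ℝ] F) (e : E) :
    Set.EqOn (dirDeriv e (f ∘ A)) (dirDeriv (A e) f ∘ A) (A ⁻¹' Ω) := fun u hu => by
  simp only [dirDeriv, Function.comp_apply]
  rw [fderiv_comp u (differentiableAt_of_contDiffOn_succ hΩ hf hu) A.differentiableAt]
  simp

lemma dirDeriv_iterate_comp (hΩ : IsOpen Ω) {n k : ℕ} (hf : ContDiffOn ℝ (n + k : ℕ) f Ω)
    (A : E →L[ℝ] F) (e : E) :
    Set.EqOn ((dirDeriv e)^[k] (f ∘ A)) ((dirDeriv (A e))^[k] f ∘ A) (A ⁻¹' Ω) := by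
  induction k generalizing f with
  | zero => exact fun _ _ => rfl
  | succ k ih =>
    exact (dirDeriv_iterate_congr (hΩ.preimage A.continuous) (dirDeriv_comp hΩ hf A e) e k).trans
      (ih (contDiffOn_dirDeriv hΩ hf (A e)))

lemma lapDir_comp (hΩ : IsOpen Ω) {n : ℕ} (hf : ContDiffOn ℝ (n + 2 : ℕ) f Ω)
    (A : E →L[ℝ] F) (a b : E) :
    Set.EqOn (lapDir a b (f ∘ A)) (lapDir (A a) (A b) f ∘ A) (A ⁻¹' Ω) := fun _ hu =>
  congrArg₂ (· + ·) (dirDeriv_iterate_comp (k := 2) hΩ hf A a hu)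
    (dirDeriv_iterate_comp (k := 2) hΩ hf A b hu)

lemma lapDir_iterate_comp (hΩ : IsOpen Ω) {n k : ℕ} (hf : ContDiffOn ℝ (n + 2 * k : ℕ) f Ω)
    (A : E →L[ℝ] F) (a b : E) :
    Set.EqOn ((lapDir a b)^[k] (f ∘ A)) ((lapDir (A a) (A b))^[k] f ∘ A) (A ⁻¹' Ω) := by
  induction k generalizing f with
  | zero => exact fun _ _ => rfl
  | succ k ih =>
    exact (lapDir_iterate_congr (hΩ.preimage A.continuous)
      (lapDir_comp (n := n + 2 * k) hΩ hf A a b) a b k).trans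
      (ih (contDiffOn_lapDir hΩ hf (A a) (A b)))

lemma cauchyDir_comp (hΩ : IsOpen Ω) {n : ℕ} (hf : ContDiffOn ℝ (n + 1 : ℕ) f Ω)
    (A : E →L[ℝ] F) (a b : E) :
    Set.EqOn (cauchyDir a b (f ∘ A)) (cauchyDir (A a) (A b) f ∘ A) (A ⁻¹' Ω) := fun _ hu =>
  congrArg₂ (fun x y => x + qi * y) (dirDeriv_comp hΩ hf A a hu) (dirDeriv_comp hΩ hf A b hu)

/-- The operators `δ^𝐡` commute with composition with a linear map. -/
lemma delta_comp (hΩ : IsOpen Ω) {k l m : ℕ} (hf : ContDiffOn ℝ (k + l + m : ℕ) f Ω)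
    (A : E →L[ℝ] F) (a b : E) :
    Set.EqOn
      ((dirDeriv a)^[k] ((dirDeriv b)^[l] ((lapDir a b)^[m / 2]
        (if m % 2 = 1 then cauchyDir a b (f ∘ A) else f ∘ A))))
      ((dirDeriv (A a))^[k] ((dirDeriv (A b))^[l] ((lapDir (A a) (A b))^[m / 2]
        (if m % 2 = 1 then cauchyDir (A a) (A b) f else f))) ∘ A) (A ⁻¹' Ω) := by
  have hV := hΩ.preimage A.continuous
  have hbase : ∃ g : F → H, g = (if m % 2 = 1 then cauchyDir (A a) (A b) f else f) ∧
      ContDiffOn ℝ (k + l + 2 * (m / 2) : ℕ) g Ω ∧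
      Set.EqOn (if m % 2 = 1 then cauchyDir a b (f ∘ A) else f ∘ A) (g ∘ A) (A ⁻¹' Ω) := by
    refine ⟨_, rfl, ?_⟩
    split_ifs with hodd
    · have hf' : ContDiffOn ℝ (k + l + 2 * (m / 2) + 1 : ℕ) f Ω := by
        rwa [show k + l + 2 * (m / 2) + 1 = k + l + m by omega]
      exact ⟨contDiffOn_cauchyDir hΩ hf' _ _, cauchyDir_comp hΩ hf' A a b⟩
    · rw [show k + l + 2 * (m / 2) = k + l + m by omega]
      exact ⟨hf, fun _ _ => rfl⟩
  obtain ⟨g, hg, hgs, hgA⟩ := hbase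
  rw [← hg]
  have h1 := (lapDir_iterate_congr hV hgA a b (m / 2)).trans (lapDir_iterate_comp hΩ hgs A a b)
  have hs1 := contDiffOn_lapDir_iterate hΩ hgs (A a) (A b)
  have h2 := (dirDeriv_iterate_congr hV h1 b l).trans (dirDeriv_iterate_comp hΩ hs1 A b)
  have hs2 := contDiffOn_dirDeriv_iterate hΩ hs1 (A b)
  rw [← Nat.zero_add k] at hs2
  exact (dirDeriv_iterate_congr hV h2 a k).trans (dirDeriv_iterate_comp hΩ hs2 A a)

end Restriction

end DirectionalDerivative

/-- The coordinate map `psi J` as a continuous linear map. -/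
def psiL (J : H) : ℝ × ℝ × ℝ →L[ℝ] H :=
  (ContinuousLinearMap.fst ℝ ℝ (ℝ × ℝ)).smulRight (1 : H) +
    ((ContinuousLinearMap.fst ℝ ℝ ℝ).comp (ContinuousLinearMap.snd ℝ ℝ (ℝ × ℝ))).smulRight qi +
    ((ContinuousLinearMap.snd ℝ ℝ ℝ).comp (ContinuousLinearMap.snd ℝ ℝ (ℝ × ℝ))).smulRight J

lemma coe_psiL (J : H) : ⇑(psiL J) = psi J := by
  funext u
  have h1 : (u.1 : H) = u.1 • (1 : H) := by ext <;> simp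
  simp [psiL, psi, h1]

lemma nabla_eq_of_monogenic {h : ℕ × ℕ × ℕ} {J : H} (hJ : J ∈ S1) {V : Set (ℝ × ℝ × ℝ)}
    (hV : IsOpen V) {φ : ℝ × ℝ × ℝ → H} (hφ : ContDiffOn ℝ h.2.2 φ V)
    (hm : ∀ u ∈ V, pd (1, 0, 0) φ u + qi * pd (0, 1, 0) φ u + J * pd (0, 0, 1) φ u = 0)
    {u : ℝ × ℝ × ℝ} (hu : u ∈ V) : nabla h φ u = J ^ h.2.2 * deltaOp h φ u := by
  have hm' : Set.EqOn (dirDeriv (0, 0, 1) φ) (J • cauchyDir (1, 0, 0) (0, 1, 0) φ) V := by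
    intro v hv
    have hCauchy : cauchyDir (1, 0, 0) (0, 1, 0) φ v = -(J * pd (0, 0, 1) φ v) :=
      eq_neg_of_add_eq_zero_left (hm v hv)
    rw [Pi.smul_apply, hCauchy, smul_eq_mul, mul_neg, ← mul_assoc, S1.mul_self hJ]
    simp [dirDeriv, pd]
  have hpow : J ^ h.2.2 ≠ 0 := pow_ne_zero _ (S1.ne_zero hJ)
  have key := dirDeriv_iterate_congr hV (dirDeriv_iterate_congr hV
    (dirDeriv_iterate_of_monogenic hJ hV h.2.2 hφ hm') (0, 1, 0) h.2.1) (1, 0, 0) h.1 hu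
  rw [dirDeriv_iterate_smul hpow, dirDeriv_iterate_smul hpow] at key
  exact key

/-- fix `𝐡 = (h₀,h₁,h₂) ∈ ℕ³` and `J ∈ S¹`.
(a) If `φ` is a smooth `J`-monogenic function on an open `V ⊆ ℝ³_J` (in coordinates),
then `∇^𝐡_Jφ = J^{h₂}·δ^𝐡_Jφ` on `V`.
(b) If `f` is a `(1,3)`-regular function of class `C^{|𝐡|}` on a domain `Ω ⊆ ℍ`, then
the restriction of `δ^𝐡f` to `Ω ∩ ℝ³_J` equals `J^{−h₂}·∇^𝐡_J f_J`. -/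
theorem stmt10 (h : ℕ × ℕ × ℕ) (J : H) (hJ : J ∈ S1) :
    (∀ V : Set (ℝ × ℝ × ℝ), IsOpen V →
      ∀ φ : ℝ × ℝ × ℝ → H, ContDiffOn ℝ (⊤ : ℕ∞) φ V →
        (∀ u ∈ V,
          pd (1, 0, 0) φ u + qi * pd (0, 1, 0) φ u + J * pd (0, 0, 1) φ u = 0) →
        ∀ u ∈ V, nabla h φ u = J ^ h.2.2 * deltaOp h φ u) ∧
    (∀ Ω : Set H, IsOpen Ω → IsConnected Ω →
      ∀ f : H → H, Regular13 f Ω →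
        ContDiffOn ℝ (h.1 + h.2.1 + h.2.2 : ℕ) f Ω →
        ∀ u : ℝ × ℝ × ℝ, psi J u ∈ Ω →
          deltaOpH h f (psi J u) = (J⁻¹) ^ h.2.2 * nabla h (fun v => f (psi J v)) u) := by
  refine ⟨fun V hV φ hφ hm u hu => nabla_eq_of_monogenic hJ hV
    (hφ.of_le (by exact_mod_cast le_top)) hm hu, fun Ω hΩ _ f hf hfs u hu => ?_⟩
  have hV : IsOpen (psi J ⁻¹' Ω) := by
    rw [← coe_psiL]
    exact hΩ.preimage (psiL J).continuous
  have hcomp : ContDiffOn ℝ h.2.2 (fun v => f (psi J v)) (psi J ⁻¹' Ω) := by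
    rw [← coe_psiL]
    exact (hfs.of_le (by norm_cast; omega)).comp (psiL J).contDiff.contDiffOn
      (Set.mapsTo_preimage _ _)
  rw [nabla_eq_of_monogenic hJ hV hcomp (fun v hv => (hf J hJ v hv).2) hu, ← mul_assoc, inv_pow,
    inv_mul_cancel₀ (pow_ne_zero _ (S1.ne_zero hJ)), one_mul]
  have hu' : u ∈ psiL J ⁻¹' Ω := by rwa [coe_psiL]
  have key := delta_comp hΩ hfs (psiL J) (1, 0, 0) (0, 1, 0) hu'
  have h1 : psi J (1, 0, 0) = 1 := by simp [psi]
  have hi : psi J (0, 1, 0) = qi := by simp [psi]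
  rw [coe_psiL, h1, hi] at key
  exact key.symm
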